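/- arXiv:2410.13014 — 6 statements merged into one kernel-verified Lean document; each statement's English description precedes it below -/
import Mathlib

section
/- Let n ≥ 1, let m_1, …, m_n be integers and let L be a finite list of integers. Define pairs of integers (P_0, Q_0) = (N(L), D(L)) and, for 1 ≤ k ≤ n, (P_k, Q_k) = R₋(m_k)(P_{k−1}, Q_{k−1}) if k is odd and (P_k, Q_k) = R₊(m_k)(P_{k−1}, Q_{k−1}) if k is even. Set M = [m_n, m_{n−1}, …, m_1] ++ L. Then (P_n, Q_n) = (N(M), D(M)) if n is even, and (P_n, Q_n) = (D(M), N(M)) if n is odd. (Equivalently, R_{(−1)^n, m_n} ∘ ⋯ ∘ R_{−1, m_1}(p/q) = [m_n; …, m_1, a_0, …, a_l]^{(−1)^n} for any continued fraction representation [a_0; a_1, …, a_l] of p/q.) -/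
/-- Numerator/denominator pair of the continued fraction determined by a list:
`cfND [] = (1, 0)`, `cfND (a :: L) = (a * N L + D L, N L)`. -/
def cfND : List ℤ → ℤ × ℤ
  | [] => (1, 0)
  | a :: L => (a * (cfND L).1 + (cfND L).2, (cfND L).1)

/-- Numerator `N` of the continued fraction of a list. -/
def cfN (L : List ℤ) : ℤ := (cfND L).1

/-- Denominator `D` of the continued fraction of a list. -/
def cfD (L : List ℤ) : ℤ := (cfND L).2

/-- The Rolfsen operation `R₊(m)(p, q) = (p + m·q, q)`. -/
def Rpos (m : ℤ) (pq : ℤ × ℤ) : ℤ × ℤ := (pq.1 + m * pq.2, pq.2)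

/-- The Rolfsen operation `R₋(m)(p, q) = (p, q + m·p)`. -/
def Rneg (m : ℤ) (pq : ℤ × ℤ) : ℤ × ℤ := (pq.1, pq.2 + m * pq.1)

theorem rolfsen_aux (m : ℕ → ℤ) (L : List ℤ)
    (P : ℕ → ℤ × ℤ) (h0 : P 0 = (cfN L, cfD L)) (n : ℕ)
    (hstep : ∀ k, 1 ≤ k → k ≤ n →
      P k = if Odd k then Rneg (m k) (P (k - 1)) else Rpos (m k) (P (k - 1))) :
    (Even n → P n = (cfN (((List.range' 1 n).map m).reverse ++ L),
      cfD (((List.range' 1 n).map m).reverse ++ L))) ∧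
    (Odd n → P n = (cfD (((List.range' 1 n).map m).reverse ++ L),
      cfN (((List.range' 1 n).map m).reverse ++ L))) := by
  induction n with
  | zero => simp [h0]
  | succ n ih =>
    obtain ⟨h1, h2⟩ := ih (fun k a b => hstep k a (by omega))
    have hs := hstep (n + 1) (by omega) le_rfl
    have hl : ((List.range' 1 (n + 1)).map m).reverse ++ L
        = m (n + 1) :: (((List.range' 1 n).map m).reverse ++ L) := by
      rw [List.range'_concat]
      simp [Nat.add_comm]
    rw [hl]
    generalize ((List.range' 1 n).map m).reverse ++ L = K at *
    rw [Nat.add_sub_cancel] at hs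
    constructor
    · intro he
      have ho : ¬ Odd (n + 1) := Nat.not_odd_iff_even.mpr he
      have hn : Odd n := by
        rw [← Nat.not_even_iff_odd]; intro h; exact ho h.add_one
      rw [hs, if_neg ho, h2 hn]
      simp only [Rpos, cfN, cfD, cfND]
      rw [add_comm]
    · intro ho
      have hn : Even n := by
        rw [← Nat.not_odd_iff_even]; intro h
        exact (Nat.not_even_iff_odd.mpr ho) h.add_one
      rw [hs, if_pos ho, h1 hn]
      simp only [Rneg, cfN, cfD, cfND]
      rw [add_comm]

theorem rolfsen_alt_comp_from_minus (n : ℕ) (hn : 1 ≤ n) (m : ℕ → ℤ) (L : List ℤ)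
    (P : ℕ → ℤ × ℤ) (h0 : P 0 = (cfN L, cfD L))
    (hstep : ∀ k, 1 ≤ k → k ≤ n →
      P k = if Odd k then Rneg (m k) (P (k - 1)) else Rpos (m k) (P (k - 1)))
    (M : List ℤ) (hM : M = ((List.range' 1 n).map m).reverse ++ L) :
    (Even n → P n = (cfN M, cfD M)) ∧ (Odd n → P n = (cfD M, cfN M)) := by
  subst hM
  exact rolfsen_aux m L P h0 n hstep
end

section
/- Let n ≥ 1, let m_1, …, m_n be integers, let a_0 be an integer and let T be a finite list of integers. Define pairs of integers (P_0, Q_0) = (N(a_0 :: T), D(a_0 :: T)) and, for 1 ≤ k ≤ n, (P_k, Q_k) = R₊(m_k)(P_{k−1}, Q_{k−1}) if k is odd and (P_k, Q_k) = R₋(m_k)(P_{k−1}, Q_{k−1}) if k is even. Set M = [m_n, …, m_2, m_1 + a_0] ++ T (for n = 1, M = (m_1 + a_0) :: T). Then (P_n, Q_n) = (N(M), D(M)) if n is odd, and (P_n, Q_n) = (D(M), N(M)) if n is even. (Equivalently, R_{(−1)^{n+1}, m_n} ∘ ⋯ ∘ R_{1, m_1}(p/q) = [m_n; …, m_1 +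 a_0, …, a_l]^{(−1)^{n+1}} for any continued fraction representation [a_0; a_1, …, a_l] of p/q.) -/
theorem rolfsen_alt_comp_from_plus (n : ℕ) (hn : 1 ≤ n) (m : ℕ → ℤ) (a0 : ℤ)
    (T : List ℤ) (P : ℕ → ℤ × ℤ) (h0 : P 0 = (cfN (a0 :: T), cfD (a0 :: T)))
    (hstep : ∀ k, 1 ≤ k → k ≤ n →
      P k = if Odd k then Rpos (m k) (P (k - 1)) else Rneg (m k) (P (k - 1)))
    (M : List ℤ) (hM : M = ((List.range' 2 (n - 1)).map m).reverse ++ (m 1 + a0) :: T) :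
    (Odd n → P n = (cfN M, cfD M)) ∧ (Even n → P n = (cfD M, cfN M)) := by
  subst hM
  induction n, hn using Nat.le_induction with
  | base =>
    have h := hstep 1 le_rfl le_rfl
    refine ⟨fun _ => ?_, fun h => absurd h (by decide)⟩
    rw [h, if_pos odd_one]
    simp only [Nat.sub_self, h0, Rpos, cfN, cfD, cfND, List.range'_zero, List.map_nil,
      List.reverse_nil, List.nil_append, Prod.mk.injEq, and_true]
    ring
  | succ n hn ih =>
    have ih := ih (fun k h1 h2 => hstep k h1 (by omega))
    have h := hstep (n + 1) (by omega) le_rfl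
    obtain ⟨j, rfl⟩ : ∃ j, n = j + 1 := ⟨n - 1, by omega⟩
    have e : ((List.range' 2 (j + 1 + 1 - 1)).map m).reverse ++ (m 1 + a0) :: T
        = m (j + 1 + 1) :: (((List.range' 2 (j + 1 - 1)).map m).reverse ++ (m 1 + a0) :: T) := by
      have e2 : 2 + j = j + 1 + 1 := by omega
      simp [List.range'_concat, e2]
    rw [e]
    generalize ((List.range' 2 (j + 1 - 1)).map m).reverse ++ (m 1 + a0) :: T = L at ih
    simp only [Nat.add_sub_cancel] at h
    constructor
    · intro ho
      have he : Even (j + 1) := by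
        rcases Nat.even_or_odd (j + 1) with h | h
        · exact h
        · exact absurd ho (Nat.not_odd_iff_even.mpr h.add_one)
      rw [h, if_pos ho, ih.2 he]
      simp only [Rpos, cfN, cfD, cfND, Prod.mk.injEq, and_true]
      ring
    · intro he
      have ho : Odd (j + 1) := by
        rcases Nat.even_or_odd (j + 1) with h | h
        · exact absurd he (Nat.not_even_iff_odd.mpr h.add_one)
        · exact h
      rw [h, if_neg (Nat.not_odd_iff_even.mpr he), ih.1 ho]
      simp only [Rneg, cfN, cfD, cfND, Prod.mk.injEq, true_and]
      ring
end

section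
/- Let L = [a_0, a_1, …, a_l] be a list of integers with l ≥ 1 and let 0 ≤ i ≤ l − 1. Define pairs of integers (P_{−1}, Q_{−1}) = (N(L), D(L)) and, for 0 ≤ k ≤ i, (P_k, Q_k) = R₊(−a_k)(P_{k−1}, Q_{k−1}) if k is even and (P_k, Q_k) = R₋(−a_k)(P_{k−1}, Q_{k−1}) if k is odd. Set T = [a_{i+1}, …, a_l]. Then (P_i, Q_i) = (N(T), D(T)) if i is odd, and (P_i, Q_i) = (D(T), N(T)) if i is even. (Equivalently, R_{(−1)^i, −a_i} ∘ ⋯ ∘ R_{1, −a_0}(p/q) = [a_{i+1}; …, a_l]^{(−1)^{i+1}} where [a_0; a_1, …, a_l] is a continued fraction representation of p/q.) -/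
theorem rolfsen_cancel_prefix (l : ℕ) (hl : 1 ≤ l) (a : ℕ → ℤ) (i : ℕ) (hi : i + 1 ≤ l)
    (L : List ℤ) (hL : L = (List.range (l + 1)).map a)
    (P : ℕ → ℤ × ℤ) (h0 : P 0 = (cfN L, cfD L))
    (hstep : ∀ k, k ≤ i →
      P (k + 1) = if Even k then Rpos (-(a k)) (P k) else Rneg (-(a k)) (P k))
    (T : List ℤ) (hT : T = (List.range' (i + 1) (l - i)).map a) :
    (Odd i → P (i + 1) = (cfN T, cfD T)) ∧ (Even i → P (i + 1) = (cfD T, cfN T)) := by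
  have key : ∀ k, k ≤ i + 1 → P k = if Even k
      then (cfN ((List.range' k (l + 1 - k)).map a), cfD ((List.range' k (l + 1 - k)).map a))
      else (cfD ((List.range' k (l + 1 - k)).map a), cfN ((List.range' k (l + 1 - k)).map a)) := by
    intro k
    induction k with
    | zero =>
      intro _
      simp [h0, hL, List.range_eq_range']
    | succ k ih =>
      intro hk
      have h1 := ih (by omega)
      have h2 : l + 1 - k = (l + 1 - (k + 1)) + 1 := by omega
      rw [h2, List.range'_succ, List.map_cons] at h1
      rw [hstep k (by omega), h1]
      by_cases he : Even k
      · simp [he, Nat.even_add_one, Rpos, cfN, cfD, cfND]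
      · simp [he, Nat.even_add_one, Rneg, cfN, cfD, cfND]
  have h := key (i + 1) le_rfl
  have h3 : l + 1 - (i + 1) = l - i := by omega
  rw [h3, ← hT] at h
  constructor
  · intro ho
    rw [h, if_pos (by simpa [Nat.even_add_one] using ho)]
  · intro he
    rw [h, if_neg (by simpa [Nat.even_add_one] using he)]
end

section
/- Let l ≥ 0, let a_0, …, a_l be integers, and let L = [a_0, …, a_{l−1}, a_l + 1] (the list whose last entry is a_l + 1). Define pairs of integers (P_{−1}, Q_{−1}) = (N(L), D(L)) and, for 0 ≤ k ≤ l, (P_k, Q_k) = R₊(−a_k)(P_{k−1}, Q_{k−1}) if k is even and (P_k, Q_k) = R₋(−a_k)(P_{k−1}, Q_{k−1}) if k is odd. Then (P_l, Q_l) = (1, 1). (Equivalently, R_{(−1)^l, −a_l} ∘ ⋯ ∘ R_{1, −a_0}(p/q) = 1 whenever [a_0; a_1, …, a_l + 1] is a continued fraction representation of p/q.) -/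
theorem rolfsen_cancel_all (l : ℕ) (a : ℕ → ℤ)
    (L : List ℤ) (hL : L = (List.range l).map a ++ [a l + 1])
    (P : ℕ → ℤ × ℤ) (h0 : P 0 = (cfN L, cfD L))
    (hstep : ∀ k, k ≤ l →
      P (k + 1) = if Even k then Rpos (-(a k)) (P k) else Rneg (-(a k)) (P k)) :
    P (l + 1) = (1, 1) := by
  have key : ∀ k, k ≤ l → P k = if Even k then cfND (L.drop k) else (cfND (L.drop k)).swap := by
    intro k
    induction k with
    | zero => intro _; simp [h0, cfN, cfD]
    | succ k ih =>
      intro hk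
      have hd : L.drop k = a k :: L.drop (k + 1) := by
        have hlen : k < L.length := by simp [hL]; omega
        rw [List.drop_eq_getElem_cons hlen]
        congr 1
        subst hL
        rw [List.getElem_append_left (by simp; omega)]
        simp
      rw [hstep k (by omega), ih (by omega), hd]
      by_cases he : Even k
      · simp [he, Nat.even_add_one, Rpos, cfND, Prod.swap]
      · simp [he, Nat.even_add_one, Rneg, cfND, Prod.swap]
  have hd : L.drop l = [a l + 1] := by
    subst hL
    rw [List.drop_append_of_le_length (by simp)]
    simp
  rw [hstep l le_rfl, key l le_rfl, hd]
  by_cases he : Even l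
  · simp [he, Rpos, cfND]
  · simp [he, Rneg, cfND]
end

section
/- Let A = [a_0, a_1, …, a_n] be a nonempty list of integers and let Ā = [−a_n, −a_{n−1}, …, −a_0] be the reverse of A with all entries negated. Then N(Ā ++ [0] ++ A) = 0 and D(Ā ++ [0] ++ A) = 1; that is, the continued fraction [−a_n; −a_{n−1}, …, −a_0, 0, a_0, a_1, …, a_n] has value 0. -/
theorem cfND_append_congr (X L L' : List ℤ) (h : cfND L = cfND L') :
    cfND (X ++ L) = cfND (X ++ L') := by
  induction X with
  | nil => simpa using h
  | cons a X ih => simp only [List.cons_append, cfND, ih]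

theorem cfND_palindrome (A : List ℤ) :
    cfND ((A.map fun x => -x).reverse ++ [0] ++ A) = (0, 1) := by
  induction A with
  | nil => simp [cfND]
  | cons a A ih =>
    rw [← ih]
    simp only [List.map_cons, List.reverse_cons, List.append_assoc]
    apply cfND_append_congr
    simp [cfND]

theorem palindrome_zero (A : List ℤ) (hA : A ≠ []) :
    cfN ((A.map fun x => -x).reverse ++ [0] ++ A) = 0 ∧
    cfD ((A.map fun x => -x).reverse ++ [0] ++ A) = 1 := by
  unfold cfN cfD
  rw [cfND_palindrome A]
  exact ⟨rfl, rfl⟩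
end

section
/- Let p and q be coprime integers with q ≥ 1 and let L = [a_0, a_1, …, a_n] be the standard continued fraction of p/q (i.e. L is a standard continued fraction with N(L) = p and D(L) = q). Suppose x, y are integers and e ∈ {1, −1} with p·x − q·y = e. Then there exist an integer l and a sign ε ∈ {1, −1} such that y = ε·N(L ++ [l]) and x = ε·D(L ++ [l]); in particular y/x = [a_0; a_1, …, a_n, l] as elements of ℚ ∪ {1/0}. -/
/-- A list `[a₀, a₁, …, a_n]` of integers is a standard continued fraction if
`a_i ≥ 1` for all `1 ≤ i ≤ n` and the last entry is at least `2` whenever `n ≥ 1`. -/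
def IsStandardCF (L : List ℤ) : Prop :=
  (∀ i (h : i < L.length), 1 ≤ i → 1 ≤ L.get ⟨i, h⟩) ∧
  (2 ≤ L.length → ∀ x, L.getLast? = some x → 2 ≤ x)

theorem cf_aux (L : List ℤ) : ∀ (x y e : ℤ), (e = 1 ∨ e = -1) →
    (cfND L).1 * x - (cfND L).2 * y = e →
    ∃ l ε : ℤ, (ε = 1 ∨ ε = -1) ∧ y = ε * (cfND (L ++ [l])).1 ∧ x = ε * (cfND (L ++ [l])).2 := by
  induction L with
  | nil =>
    intro x y e he h
    simp only [cfND] at h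
    refine ⟨e * y, e, he, ?_, ?_⟩ <;> rcases he with rfl | rfl <;> simp [cfND] <;> linarith
  | cons a L ih =>
    intro x y e he h
    simp only [cfND] at h
    obtain ⟨l, ε, hε, h1, h2⟩ := ih (y - a * x) x (-e) (by rcases he with rfl | rfl <;> simp)
      (by linarith)
    refine ⟨l, ε, hε, ?_, ?_⟩
    · simp only [List.cons_append, cfND]
      linear_combination h2 + a * h1
    · simpa only [List.cons_append, cfND] using h1

theorem int_solutions_append (p q : ℤ) (hpq : IsCoprime p q) (hq : 1 ≤ q)
    (L : List ℤ) (hL : L ≠ []) (hstd : IsStandardCF L)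
    (hN : cfN L = p) (hD : cfD L = q)
    (x y e : ℤ) (he : e = 1 ∨ e = -1) (hxy : p * x - q * y = e) :
    ∃ l ε : ℤ, (ε = 1 ∨ ε = -1) ∧ y = ε * cfN (L ++ [l]) ∧ x = ε * cfD (L ++ [l]) := by
  subst hN hD
  exact cf_aux L x y e he hxy
end
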